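/- Let π : Γ → Δ be a tropical admissible cover. The pushforward morphism π_* : Div(Γ) → Div(Δ) maps effective divisors to effective divisors and preserves linear equivalence; for every D ∈ Div(Γ), deg(π_*D) = deg(D) and rk(D) ≤ rk(π_*D). -/

import Mathlib

open scoped Classical

noncomputable section

/-! ## Combinatorial models of metric graphs and their topological realizations -/

/-- A combinatorial model of a metric graph: a finite multigraph with positive
edge lengths. -/
structure CombGraph : Type 1 where
  V : Type
  E : Type
  fintypeV : Fintype V
  fintypeE : Fintype E
  src : E → V
  tgt : E → V
  len : E → ℝ
  len_pos : ∀ e, 0 < len e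

attribute [instance] CombGraph.fintypeV CombGraph.fintypeE

namespace CombGraph

variable (G : CombGraph)

instance : TopologicalSpace G.V := ⊥
instance : TopologicalSpace G.E := ⊥

/-- The disjoint union of the vertices and of the edges seen as real intervals,
before gluing. -/
def Pre : Type := G.V ⊕ (G.E × ℝ)

instance : TopologicalSpace G.Pre := inferInstanceAs (TopologicalSpace (G.V ⊕ (G.E × ℝ)))

/-- The predicate selecting legitimate points: a point of an edge `e` must have its
coordinate in `[0, len e]`. -/
def Ok : G.Pre → Prop
  | Sum.inl _ => True
  | Sum.inr p => 0 ≤ p.2 ∧ p.2 ≤ G.len p.1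

/-- Points of the model before gluing. -/
def PreR : Type := {p : G.Pre // G.Ok p}

instance : TopologicalSpace G.PreR := inferInstanceAs (TopologicalSpace {p : G.Pre // G.Ok p})

/-- The gluing relation: the endpoints of each edge are glued to the corresponding
vertices. -/
inductive Glue : G.PreR → G.PreR → Prop
  | srcGlue (e : G.E) :
      Glue ⟨Sum.inl (G.src e), trivial⟩ ⟨Sum.inr (e, 0), ⟨le_refl 0, (G.len_pos e).le⟩⟩
  | tgtGlue (e : G.E) :
      Glue ⟨Sum.inl (G.tgt e), trivial⟩ ⟨Sum.inr (e, G.len e), ⟨(G.len_pos e).le, le_refl _⟩⟩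

/-- The topological realization of the combinatorial model: the underlying
topological space of the associated metric graph. -/
def Space : Type := Quot G.Glue

instance : TopologicalSpace G.Space := inferInstanceAs (TopologicalSpace (Quot G.Glue))

/-- The point of the realization corresponding to a vertex. -/
def vertexPt (v : G.V) : G.Space := Quot.mk _ ⟨Sum.inl v, trivial⟩

/-- Clamping of a real coordinate into `[0, len e]`. -/
def clamp (e : G.E) (t : ℝ) : ℝ := max 0 (min t (G.len e))

/-- The point of the realization lying on the edge `e` at coordinate `t`
(the coordinate is clamped into `[0, len e]`). -/
def edgePt (e : G.E) (t : ℝ) : G.Space :=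
  Quot.mk _ ⟨Sum.inr (e, G.clamp e t),
    ⟨le_max_left 0 _, max_le (G.len_pos e).le (min_le_right _ _)⟩⟩

/-- The genus (first Betti number) of the (connected) metric graph. -/
def genus : ℤ := (Fintype.card G.E : ℤ) - (Fintype.card G.V : ℤ) + 1

/-! ### Outgoing directions, valence -/

/-- `d = (e, b)` is an outgoing unit tangent direction at the point `x`:
if `b = true` it points in the direction of increasing coordinate on `e`, if
`b = false` in the direction of decreasing coordinate. -/
def IsDir (x : G.Space) (d : G.E × Bool) : Prop :=
  if d.2 then ∃ t, 0 ≤ t ∧ t < G.len d.1 ∧ x = G.edgePt d.1 t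
  else ∃ t, 0 < t ∧ t ≤ G.len d.1 ∧ x = G.edgePt d.1 t

/-- The (finite) set of outgoing directions at a point. -/
def dirSet (x : G.Space) : Finset (G.E × Bool) :=
  Finset.univ.filter fun d => G.IsDir x d

/-- The valence of a point of the realization: the number of outgoing
directions at that point. -/
def valence (x : G.Space) : ℕ := (G.dirSet x).card

/-- The coordinate on the edge `d.1` of a point `x` admitting `d` as an outgoing
direction. -/
def dirCoord (x : G.Space) (d : G.E × Bool) : ℝ :=
  if d.2 then
    (if h : ∃ t, 0 ≤ t ∧ t < G.len d.1 ∧ x = G.edgePt d.1 t then h.choose else 0)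
  else
    (if h : ∃ t, 0 < t ∧ t ≤ G.len d.1 ∧ x = G.edgePt d.1 t then h.choose else 0)

/-- The point at distance `u` from `x` in the outgoing direction `d`. -/
def dirPt (x : G.Space) (d : G.E × Bool) (u : ℝ) : G.Space :=
  G.edgePt d.1 (G.dirCoord x d + (if d.2 then u else -u))

end CombGraph

/-! ### Rational functions and divisors -/

/-- A function `g : [0, L] → ℝ` is piecewise integral affine if there is a finite
subdivision of `[0, L]` on whose pieces `g` is affine with integral slope. -/
def PWIntAffine (g : ℝ → ℝ) (L : ℝ) : Prop :=
  ∃ (n : ℕ) (t : ℕ → ℝ) (m : ℕ → ℤ) (b : ℕ → ℝ),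
    t 0 = 0 ∧ t n = L ∧ (∀ i, i < n → t i < t (i + 1)) ∧
    (∀ i, i < n → ∀ u, t i ≤ u → u ≤ t (i + 1) → g u = (m i : ℝ) * u + b i)

/-- A rational function on the metric graph realizing `G`: a continuous function
which is piecewise integral affine on every edge. -/
structure RatFn (G : CombGraph) where
  toFun : G.Space → ℝ
  continuous : Continuous toFun
  piecewise : ∀ e : G.E, PWIntAffine (fun t => toFun (G.edgePt e t)) (G.len e)

namespace CombGraph

variable (G : CombGraph)

/-- The right-hand slope of a rational function on the edge `e` at coordinate `t`. -/
def rightSlope (f : RatFn G) (e : G.E) (t : ℝ) : ℝ :=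
  derivWithin (fun u => f.toFun (G.edgePt e u)) (Set.Ici t) t

/-- The left-hand slope of a rational function on the edge `e` at coordinate `t`. -/
def leftSlope (f : RatFn G) (e : G.E) (t : ℝ) : ℝ :=
  derivWithin (fun u => f.toFun (G.edgePt e u)) (Set.Iic t) t

/-- The order of a rational function at a point: the sum of its outgoing slopes. -/
def ordAt (f : RatFn G) (x : G.Space) : ℝ :=
  if h : ∃ v : G.V, x = G.vertexPt v then
    ∑ e : G.E,
      ((if G.src e = h.choose then G.rightSlope f e 0 else 0)
        + (if G.tgt e = h.choose then -(G.leftSlope f e (G.len e)) else 0))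
  else if h2 : ∃ p : G.E × ℝ, 0 < p.2 ∧ p.2 < G.len p.1 ∧ x = G.edgePt p.1 p.2 then
    G.rightSlope f h2.choose.1 h2.choose.2 - G.leftSlope f h2.choose.1 h2.choose.2
  else 0

/-- The group of divisors of the metric graph: the free abelian group on the
points of the realization. -/
abbrev Div (G : CombGraph) : Type := G.Space →₀ ℤ

/-- The degree of a divisor. -/
def degDiv (D : Div G) : ℤ := D.sum fun _ n => n

/-- A divisor is effective if all of its coefficients are nonnegative. -/
def Effective (D : Div G) : Prop := ∀ x, 0 ≤ D x

/-- `D` is the principal divisor associated to the rational function `f`. -/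
def IsPrincipal (D : Div G) (f : RatFn G) : Prop := ∀ x, (D x : ℝ) = G.ordAt f x

/-- Two divisors are linearly equivalent if their difference is principal. -/
def LinEquiv (D D' : Div G) : Prop := ∃ f : RatFn G, G.IsPrincipal (D - D') f

/-- The Baker–Norine rank of a divisor: the largest integer `k` such that for every
effective divisor `E` of degree `k` the linear system `|D - E|` is nonempty.  (For
negative `k` the condition is vacuous, so the supremum is `-1` exactly when
`|D|` is empty.) -/
def Rk (D : Div G) : ℤ :=
  sSup {k : ℤ | ∀ E : Div G, G.Effective E → G.degDiv E = k →
    ∃ E' : Div G, G.Effective E' ∧ G.LinEquiv (D - E) E'}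

/-- A point of a metric graph is a Weierstrass point if `rk(g·[x]) ≥ 1`. -/
def IsWeierstrass (x : G.Space) : Prop :=
  1 ≤ G.Rk (G.genus • Finsupp.single x 1)

/-- The canonical divisor of a metric graph. -/
def canonical : Div G :=
  ∑ v : G.V, ((G.valence (G.vertexPt v) : ℤ) - 2) • Finsupp.single (G.vertexPt v) 1

end CombGraph
/-! ### Tropical admissible covers -/

/-- A tropical admissible cover between the metric graphs realizing `G` and `D`:
a continuous surjective map with finite fibers which is locally integral affine
(witnessed by the data of the image direction `dirMap` and the absolute value
`slope` of the integral slope along every outgoing direction), such that the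
local degree is well defined at every point, and all Riemann–Hurwitz numbers are
nonnegative. -/
structure TropCover (G D : CombGraph) where
  toFun : G.Space → D.Space
  continuous : Continuous toFun
  surjective : Function.Surjective toFun
  finiteFibers : ∀ y : D.Space, (toFun ⁻¹' {y}).Finite
  dirMap : G.Space → G.E × Bool → D.E × Bool
  slope : G.Space → G.E × Bool → ℕ
  localDeg : G.Space → ℕ
  dirMap_isDir : ∀ x d, G.IsDir x d → D.IsDir (toFun x) (dirMap x d)
  locAffine : ∀ x d, G.IsDir x d → ∃ ε > (0 : ℝ), ∀ u, 0 ≤ u → u ≤ ε →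
      toFun (G.dirPt x d u) = D.dirPt (toFun x) (dirMap x d) ((slope x d : ℝ) * u)
  localDeg_spec : ∀ x d', D.IsDir (toFun x) d' →
      localDeg x = ∑ d ∈ (G.dirSet x).filter (fun d => dirMap x d = d'), slope x d
  rh_nonneg : ∀ x, 0 ≤ (G.valence x : ℤ) - 2 - (localDeg x : ℤ) * ((D.valence (toFun x) : ℤ) - 2)

namespace TropCover

variable {G D : CombGraph} (π : TropCover G D)

/-- The fiber of a point as a finite set. -/
def fiber (y : D.Space) : Finset G.Space := (π.finiteFibers y).toFinset

/-- The pullback `π*[y]` of the divisor `[y]`. -/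
def fiberDiv (y : D.Space) : CombGraph.Div G :=
  ∑ z ∈ π.fiber y, (π.localDeg z : ℤ) • Finsupp.single z 1

/-- The pullback morphism on divisors. -/
def pullback (A : CombGraph.Div D) : CombGraph.Div G :=
  A.sum fun y n => n • π.fiberDiv y

/-- The pushforward morphism on divisors. -/
def pushforward (A : CombGraph.Div G) : CombGraph.Div D :=
  Finsupp.mapDomain π.toFun A

/-- The degree of the cover, computed at the point `y` of the target. -/
def degAt (y : D.Space) : ℕ := ∑ z ∈ π.fiber y, π.localDeg z

/-- The Riemann–Hurwitz number of the cover at a point of the source. -/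
def rhNum (x : G.Space) : ℤ :=
  (G.valence x : ℤ) - 2 - (π.localDeg x : ℤ) * ((D.valence (π.toFun x) : ℤ) - 2)

/-- The (finite) set of points where the ramification divisor may be supported:
the vertices of the source together with the fibers of the vertices of the target
(at every other point the Riemann–Hurwitz number vanishes). -/
def ramSupport : Finset G.Space :=
  Finset.univ.image G.vertexPt ∪
    Finset.univ.biUnion fun v : D.V => π.fiber (D.vertexPt v)

/-- The ramification divisor `R_π = Σ_x r_π(x)·[x]` of the cover. -/
def ramDiv : CombGraph.Div G :=
  ∑ x ∈ π.ramSupport, π.rhNum x • Finsupp.single x 1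

end TropCover

namespace CombGraph

open Filter Topology

section Realization

variable {G : CombGraph}

instance : DiscreteTopology G.V := ⟨rfl⟩
instance : DiscreteTopology G.E := ⟨rfl⟩

theorem clamp_of_mem {e : G.E} {t : ℝ} (h0 : 0 ≤ t) (h1 : t ≤ G.len e) : G.clamp e t = t := by
  simp [clamp, h0, h1]

theorem clamp_mem (e : G.E) (t : ℝ) : 0 ≤ G.clamp e t ∧ G.clamp e t ≤ G.len e :=
  ⟨le_max_left 0 _, max_le (G.len_pos e).le (min_le_right _ _)⟩

theorem mk_inr_eq_edgePt (e : G.E) (t : ℝ) (h : G.Ok (Sum.inr (e, t))) :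
    (Quot.mk G.Glue ⟨Sum.inr (e, t), h⟩ : G.Space) = G.edgePt e t := by
  have h' : G.clamp e t = t := clamp_of_mem h.1 h.2
  simp only [edgePt, h']

theorem edgePt_clamp (e : G.E) (t : ℝ) : G.edgePt e (G.clamp e t) = G.edgePt e t :=
  (mk_inr_eq_edgePt e _ (clamp_mem e t)).symm

theorem edgePt_zero (e : G.E) : G.edgePt e 0 = G.vertexPt (G.src e) := by
  rw [← mk_inr_eq_edgePt e 0 ⟨le_refl 0, (G.len_pos e).le⟩]
  exact (Quot.sound (Glue.srcGlue e)).symm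

theorem edgePt_len (e : G.E) : G.edgePt e (G.len e) = G.vertexPt (G.tgt e) := by
  rw [← mk_inr_eq_edgePt e (G.len e) ⟨(G.len_pos e).le, le_refl _⟩]
  exact (Quot.sound (Glue.tgtGlue e)).symm

/-- A function on the realization built from its values on vertices and edges. -/
def glueFn {X : Type*} (a : G.V → X) (b : G.E → ℝ → X) (h0 : ∀ e, b e 0 = a (G.src e))
    (h1 : ∀ e, b e (G.len e) = a (G.tgt e)) : G.Space → X :=
  Quot.lift (fun p => Sum.elim a (fun q => b q.1 q.2) p.1) (by
    rintro _ _ (e | e)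
    · exact (h0 e).symm
    · exact (h1 e).symm)

theorem glueFn_edgePt {X : Type*} (a : G.V → X) (b : G.E → ℝ → X) (h0 h1) (e : G.E) (t : ℝ) :
    glueFn (G := G) a b h0 h1 (G.edgePt e t) = b e (G.clamp e t) := rfl

theorem glueFn_vertexPt {X : Type*} (a : G.V → X) (b : G.E → ℝ → X) (h0 h1) (v : G.V) :
    glueFn (G := G) a b h0 h1 (G.vertexPt v) = a v := rfl

/-- The normal form of a point: a vertex, or an edge with a coordinate. -/
def normalForm : G.Space → G.V ⊕ (G.E × ℝ) :=
  glueFn Sum.inl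
    (fun e t => if t = 0 then Sum.inl (G.src e) else if t = G.len e then Sum.inl (G.tgt e)
      else Sum.inr (e, t))
    (fun e => by simp) (fun e => by simp [(G.len_pos e).ne'])

theorem normalForm_vertexPt (v : G.V) : normalForm (G.vertexPt v) = Sum.inl v := rfl

theorem normalForm_edgePt {e : G.E} {t : ℝ} (h0 : 0 < t) (h1 : t < G.len e) :
    normalForm (G.edgePt e t) = Sum.inr (e, t) := by
  rw [normalForm, glueFn_edgePt, clamp_of_mem h0.le h1.le, if_neg h0.ne', if_neg h1.ne]

theorem vertexPt_injective : Function.Injective G.vertexPt := fun v w h => by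
  simpa [normalForm_vertexPt] using congrArg normalForm h

theorem edgePt_ne_vertexPt {e : G.E} {t : ℝ} (h0 : 0 < t) (h1 : t < G.len e) (v : G.V) :
    G.edgePt e t ≠ G.vertexPt v := fun h => by
  simpa [normalForm_vertexPt, normalForm_edgePt h0 h1] using congrArg normalForm h

theorem eq_vertexPt_or_edgePt (x : G.Space) :
    (∃ v, x = G.vertexPt v) ∨ ∃ e t, 0 < t ∧ t < G.len e ∧ x = G.edgePt e t := by
  induction x using Quot.ind with
  | mk p =>
    obtain ⟨v | ⟨e, t⟩, h⟩ := p
    · exact Or.inl ⟨v, rfl⟩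
    · rw [mk_inr_eq_edgePt]
      obtain ⟨h0, h1⟩ : 0 ≤ t ∧ t ≤ G.len e := h
      rcases h0.eq_or_lt with rfl | h0
      · exact Or.inl ⟨_, edgePt_zero e⟩
      rcases h1.eq_or_lt with rfl | h1
      · exact Or.inl ⟨_, edgePt_len e⟩
      exact Or.inr ⟨e, t, h0, h1, rfl⟩

theorem continuous_edgePt (e : G.E) : Continuous (G.edgePt e) := by
  have h : Continuous fun t => (⟨Sum.inr (e, G.clamp e t), clamp_mem e t⟩ : G.PreR) := by
    refine Continuous.subtype_mk (continuous_inr.comp ?_) _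
    refine continuous_const.prodMk ?_
    unfold clamp
    fun_prop
  exact continuous_quot_mk.comp h

theorem continuous_of_edges {X : Type*} [TopologicalSpace X] {F : G.Space → X}
    (h : ∀ e, Continuous fun t => F (G.edgePt e t)) : Continuous F := by
  refine continuous_coinduced_dom.2 ?_
  have h2 : Continuous (Sum.elim (fun v => F (G.vertexPt v))
      (fun p : G.E × ℝ => F (G.edgePt p.1 p.2))) :=
    continuous_of_discreteTopology.sumElim (continuous_prod_of_discrete_left.2 h)
  have h3 : F ∘ Quot.mk G.Glue = (Sum.elim (fun v => F (G.vertexPt v))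
      (fun p : G.E × ℝ => F (G.edgePt p.1 p.2))) ∘ (fun p : G.PreR => p.1) := by
    funext p
    obtain ⟨v | ⟨e, t⟩, h⟩ := p
    · rfl
    · exact congrArg F (mk_inr_eq_edgePt e t h)
  rw [h3]
  exact h2.comp continuous_subtype_val

theorem continuous_glueFn (a : G.V → ℝ) (b : G.E → ℝ → ℝ) (h0 h1) (hb : ∀ e, Continuous (b e)) :
    Continuous (glueFn (G := G) a b h0 h1) := by
  refine continuous_of_edges fun e => ?_
  simp only [glueFn_edgePt]
  refine (hb e).comp ?_
  unfold clamp
  fun_prop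

theorem exists_continuous_eq_one_iff {e : G.E} {t : ℝ} (h0 : 0 < t) (h1 : t < G.len e) :
    ∃ F : G.Space → ℝ, Continuous F ∧ ∀ x, F x = 1 ↔ x = G.edgePt e t := by
  have hl : 0 < G.len e - t := by linarith
  let b : G.E → ℝ → ℝ := fun e' s =>
    if e' = e then min (s / t) ((G.len e - s) / (G.len e - t)) else 0
  have hb0 : ∀ e', b e' 0 = (fun _ : G.V => (0 : ℝ)) (G.src e') := by
    intro e'
    by_cases h : e' = e
    · have : 0 ≤ G.len e / (G.len e - t) := by have := G.len_pos e; positivity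
      simp [b, h, this]
    · simp [b, h]
  have hb1 : ∀ e', b e' (G.len e') = (fun _ : G.V => (0 : ℝ)) (G.tgt e') := by
    intro e'
    by_cases h : e' = e
    · subst h
      have : 0 ≤ G.len e' / t := by have := G.len_pos e'; positivity
      simp [b, this]
    · simp [b, h]
  refine ⟨glueFn (fun _ => 0) b hb0 hb1, continuous_glueFn _ _ _ _ fun e' => ?_, fun x => ?_⟩
  · by_cases h : e' = e
    · simp only [b, h, if_true]; fun_prop
    · simp only [b, h, if_false]; fun_prop
  · constructor
    · intro hx
      rcases eq_vertexPt_or_edgePt x with ⟨v, rfl⟩ | ⟨e', s, hs0, hs1, rfl⟩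
      · simp [glueFn_vertexPt] at hx
      · rw [glueFn_edgePt, clamp_of_mem hs0.le hs1.le] at hx
        by_cases h : e' = e
        · subst h
          simp only [b, if_true] at hx
          have h2 : 1 ≤ s / t := hx ▸ min_le_left _ _
          have h3 : 1 ≤ (G.len e' - s) / (G.len e' - t) := hx ▸ min_le_right _ _
          rw [le_div_iff₀ h0] at h2
          rw [le_div_iff₀ hl] at h3
          have : s = t := by linarith
          rw [this]
        · simp [b, h] at hx
    · rintro rfl
      rw [glueFn_edgePt, clamp_of_mem h0.le h1.le]
      simp [b, h0.ne', hl.ne']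

theorem exists_continuous_vertexPt_eq (v : G.V) :
    ∃ F : G.Space → ℝ, Continuous F ∧ ∀ w, F (G.vertexPt w) = if w = v then 1 else 0 := by
  let a : G.V → ℝ := fun w => if w = v then 1 else 0
  let b : G.E → ℝ → ℝ := fun e t => a (G.src e) * (1 - t / G.len e) + a (G.tgt e) * (t / G.len e)
  refine ⟨glueFn a b (fun e => by simp [b]) (fun e => by simp [b, (G.len_pos e).ne']),
    continuous_glueFn _ _ _ _ fun e => ?_, fun w => rfl⟩
  simp only [b]
  fun_prop

instance : T2Space G.Space := by
  refine ⟨fun x y hxy => ?_⟩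
  have sep : ∀ F : G.Space → ℝ, Continuous F → F x ≠ F y →
      ∃ u v, IsOpen u ∧ IsOpen v ∧ x ∈ u ∧ y ∈ v ∧ Disjoint u v :=
    fun F hF h => separated_by_continuous hF h
  rcases eq_vertexPt_or_edgePt x with ⟨v, rfl⟩ | ⟨e, t, h0, h1, rfl⟩
  · rcases eq_vertexPt_or_edgePt y with ⟨w, rfl⟩ | ⟨e, t, h0, h1, rfl⟩
    · obtain ⟨F, hF, hv⟩ := exists_continuous_vertexPt_eq v
      refine sep F hF ?_
      have : w ≠ v := fun h => hxy (h ▸ rfl)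
      simp [hv, this]
    · obtain ⟨F, hF, h⟩ := exists_continuous_eq_one_iff h0 h1
      refine sep F hF fun hh => hxy ?_
      rw [(h _).2 rfl] at hh
      exact (h _).1 hh
  · obtain ⟨F, hF, h⟩ := exists_continuous_eq_one_iff h0 h1
    refine sep F hF fun hh => hxy ?_
    rw [(h _).2 rfl] at hh
    exact ((h _).1 hh.symm).symm

end Realization

section Directions

variable {G : CombGraph}

/-- The point at coordinate `r` of the edge `d.1` oriented by `d.2`: the coordinate is measured
from the source if `d.2 = true` and from the target if `d.2 = false`. -/
def orientedPt (d : G.E × Bool) (r : ℝ) : G.Space :=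
  G.edgePt d.1 (if d.2 then r else G.len d.1 - r)

/-- The starting vertex of an oriented edge. -/
def start (d : G.E × Bool) : G.V := if d.2 then G.src d.1 else G.tgt d.1

/-- The oriented edge with the opposite orientation. -/
def flip (d : G.E × Bool) : G.E × Bool := (d.1, !d.2)

theorem flip_ne (d : G.E × Bool) : flip d ≠ d := by
  obtain ⟨e, b⟩ := d
  cases b <;> simp [flip]

theorem orientedPt_flip (d : G.E × Bool) (r : ℝ) :
    orientedPt (flip d) r = orientedPt d (G.len d.1 - r) := by
  obtain ⟨e, b⟩ := d
  cases b <;> simp [orientedPt, flip]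

theorem orientedPt_zero (d : G.E × Bool) : orientedPt d 0 = G.vertexPt (start d) := by
  obtain ⟨e, b⟩ := d
  cases b <;> simp [orientedPt, start, edgePt_zero, edgePt_len]

theorem continuous_orientedPt (d : G.E × Bool) : Continuous (orientedPt d) := by
  obtain ⟨e, b⟩ := d
  cases b
  · exact (continuous_edgePt e).comp (continuous_const.sub continuous_id)
  · exact continuous_edgePt e

theorem orientedPt_ne_vertexPt {d : G.E × Bool} {r : ℝ} (h0 : 0 < r) (h1 : r < G.len d.1)
    (v : G.V) : orientedPt d r ≠ G.vertexPt v := by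
  obtain ⟨e, b⟩ := d
  cases b
  · exact edgePt_ne_vertexPt (by simpa using h1) (by simpa using h0) v
  · exact edgePt_ne_vertexPt h0 h1 v

theorem eq_or_eq_of_orientedPt_eq {d d' : G.E × Bool} {r r' : ℝ} (h0 : 0 < r)
    (h1 : r < G.len d.1) (h0' : 0 ≤ r') (h1' : r' < G.len d'.1)
    (h : orientedPt d r = orientedPt d' r') :
    (d' = d ∧ r' = r) ∨ (d' = flip d ∧ r' = G.len d.1 - r) := by
  rcases h0'.eq_or_lt with rfl | h0'
  · rw [orientedPt_zero] at h
    exact absurd h (orientedPt_ne_vertexPt h0 h1 _)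
  obtain ⟨e, b⟩ := d
  obtain ⟨e', b'⟩ := d'
  have key : ∀ (e : G.E) (b : Bool) (r : ℝ), 0 < r → r < G.len e →
      normalForm (orientedPt (G := G) (e, b) r) =
        Sum.inr (e, if b then r else G.len e - r) := by
    intro e b r h0 h1
    cases b
    · exact normalForm_edgePt (by simpa using h1) (by simpa using h0)
    · exact normalForm_edgePt h0 h1
  have h2 := congrArg normalForm h
  rw [key e b r h0 h1, key e' b' r' h0' h1'] at h2
  simp only [Sum.inr.injEq, Prod.mk.injEq] at h2
  obtain ⟨rfl, h2⟩ := h2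
  cases b <;> cases b' <;> simp [flip] at h2 ⊢ <;> linarith

theorem orientedPt_injOn {d : G.E × Bool} {r r' : ℝ} (h0 : 0 ≤ r) (h1 : r < G.len d.1)
    (h0' : 0 ≤ r') (h1' : r' < G.len d.1) (h : orientedPt d r = orientedPt d r') : r = r' := by
  rcases h0.eq_or_lt with rfl | h0
  · rcases h0'.eq_or_lt with rfl | h0'
    · rfl
    · rw [orientedPt_zero] at h
      exact absurd h.symm (orientedPt_ne_vertexPt h0' h1' _)
  · rcases eq_or_eq_of_orientedPt_eq h0 h1 h0' h1' h with ⟨-, h⟩ | ⟨h, -⟩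
    · exact h.symm
    · exact absurd h.symm (flip_ne d)

theorem isDir_iff {x : G.Space} {d : G.E × Bool} :
    G.IsDir x d ↔ ∃ r, 0 ≤ r ∧ r < G.len d.1 ∧ x = orientedPt d r := by
  obtain ⟨e, b⟩ := d
  cases b
  · simp only [IsDir, orientedPt]
    constructor
    · rintro ⟨t, h0, h1, rfl⟩
      exact ⟨G.len e - t, by simpa using h1, by simpa using h0, by simp⟩
    · rintro ⟨t, h0, h1, rfl⟩
      exact ⟨G.len e - t, by simpa using h1, by simpa using h0, by simp⟩
  · simp [IsDir, orientedPt]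

theorem isDir_orientedPt {d : G.E × Bool} {r : ℝ} (h0 : 0 ≤ r) (h1 : r < G.len d.1) :
    G.IsDir (orientedPt d r) d :=
  isDir_iff.2 ⟨r, h0, h1, rfl⟩

theorem mem_dirSet {x : G.Space} {d : G.E × Bool} : d ∈ G.dirSet x ↔ G.IsDir x d := by
  simp [dirSet]

theorem dirPt_orientedPt {d : G.E × Bool} {r : ℝ} (h0 : 0 ≤ r) (h1 : r < G.len d.1) (u : ℝ) :
    G.dirPt (orientedPt d r) d u = orientedPt d (r + u) := by
  obtain ⟨e, b⟩ := d
  cases b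
  · have h : ∃ t, 0 < t ∧ t ≤ G.len e ∧ orientedPt (e, false) r = G.edgePt e t :=
      ⟨G.len e - r, by simpa using h1, by simpa using h0, by simp [orientedPt]⟩
    have h2 : G.dirCoord (orientedPt (e, false) r) (e, false) = G.len e - r := by
      simp only [dirCoord, Bool.false_eq_true, if_false, dif_pos h]
      obtain ⟨h3, h4, h5⟩ := h.choose_spec
      have h6 : orientedPt (G := G) (e, false) r = orientedPt (e, false) (G.len e - h.choose) := by
        conv_lhs => rw [h5]
        simp [orientedPt]
      have := orientedPt_injOn h0 h1 (by simpa using h4) (by simpa using h3) h6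
      linarith
    rw [dirPt, h2]
    simp only [orientedPt, Bool.false_eq_true, if_false]
    congr 1
    ring
  · have h : ∃ t, 0 ≤ t ∧ t < G.len e ∧ orientedPt (e, true) r = G.edgePt e t :=
      ⟨r, h0, h1, by simp [orientedPt]⟩
    have h2 : G.dirCoord (orientedPt (e, true) r) (e, true) = r := by
      simp only [dirCoord, if_true, dif_pos h]
      obtain ⟨h3, h4, h5⟩ := h.choose_spec
      have h6 : orientedPt (G := G) (e, true) r = orientedPt (e, true) h.choose := by
        conv_lhs => rw [h5]
        simp [orientedPt]
      exact (orientedPt_injOn h0 h1 h3 h4 h6).symm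
    rw [dirPt, h2]
    simp [orientedPt]

theorem dirPt_zero {x : G.Space} {d : G.E × Bool} (h : G.IsDir x d) : G.dirPt x d 0 = x := by
  obtain ⟨r, h0, h1, rfl⟩ := isDir_iff.1 h
  rw [dirPt_orientedPt h0 h1, add_zero]

theorem tendsto_dirPt {x : G.Space} {d : G.E × Bool} (h : G.IsDir x d) :
    Tendsto (G.dirPt x d) (𝓝[>] 0) (𝓝 x) := by
  obtain ⟨r, h0, h1, rfl⟩ := isDir_iff.1 h
  have h2 : G.dirPt (orientedPt d r) d = fun u => orientedPt d (r + u) :=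
    funext (dirPt_orientedPt h0 h1)
  rw [h2]
  have h3 : Continuous fun u => orientedPt d (r + u) :=
    (continuous_orientedPt d).comp (continuous_const.add continuous_id)
  have h4 := h3.tendsto 0
  simp only [add_zero] at h4
  exact h4.mono_left nhdsWithin_le_nhds

theorem eventually_lt_nhdsGT {a : ℝ} (ha : 0 < a) : ∀ᶠ u in 𝓝[>] (0 : ℝ), u < a :=
  nhdsWithin_le_nhds (Iio_mem_nhds ha)

theorem eventually_pos_nhdsGT : ∀ᶠ u in 𝓝[>] (0 : ℝ), 0 < u := self_mem_nhdsWithin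

theorem eventually_of_exists_pos {p : ℝ → Prop} (h : ∃ ε > 0, ∀ u, 0 < u → u < ε → p u) :
    ∀ᶠ u in 𝓝[>] (0 : ℝ), p u := by
  obtain ⟨ε, hε, h⟩ := h
  filter_upwards [eventually_lt_nhdsGT hε, eventually_pos_nhdsGT] with u h1 h2 using h u h2 h1

theorem exists_pos_of_eventually {p : ℝ → Prop} (h : ∀ᶠ u in 𝓝[>] (0 : ℝ), p u) :
    ∃ ε > 0, ∀ u, 0 < u → u < ε → p u := by
  obtain ⟨ε, hε, h⟩ := mem_nhdsGT_iff_exists_Ioo_subset.1 h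
  exact ⟨ε, hε, fun u h0 h1 => h ⟨h0, h1⟩⟩

theorem eventually_dirPt_ne {x : G.Space} {d : G.E × Bool} (h : G.IsDir x d) :
    ∀ᶠ u in 𝓝[>] (0 : ℝ), G.dirPt x d u ≠ x := by
  obtain ⟨r, h0, h1, rfl⟩ := isDir_iff.1 h
  filter_upwards [eventually_lt_nhdsGT (sub_pos.2 h1), eventually_pos_nhdsGT] with u h2 h3 h4
  rw [dirPt_orientedPt h0 h1] at h4
  have := orientedPt_injOn (by linarith) (by linarith) h0 h1 h4
  linarith

theorem eventually_dirPt_eq_imp {x : G.Space} {d d' : G.E × Bool} (h : G.IsDir x d)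
    (h' : G.IsDir x d') : ∀ᶠ η in 𝓝[>] (0 : ℝ), ∀ v v', 0 < v → v < η → 0 < v' → v' < η →
      G.dirPt x d v = G.dirPt x d' v' → d = d' ∧ v = v' := by
  obtain ⟨r, h0, h1, rfl⟩ := isDir_iff.1 h
  obtain ⟨r', h0', h1', hr⟩ := isDir_iff.1 h'
  filter_upwards [eventually_lt_nhdsGT (half_pos (sub_pos.2 h1)),
    eventually_lt_nhdsGT (half_pos (sub_pos.2 h1'))] with η h2 h2' v v' h3 h4 h3' h4' h5
  rw [dirPt_orientedPt h0 h1, hr, dirPt_orientedPt h0' h1'] at h5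
  rcases eq_or_eq_of_orientedPt_eq (by linarith) (by linarith) (by linarith) (by linarith) h5
    with ⟨rfl, h6⟩ | ⟨rfl, h6⟩
  · have := orientedPt_injOn h0 h1 h0' h1' hr
    exact ⟨rfl, by linarith⟩
  · exfalso
    have h7 : G.len (flip d).1 = G.len d.1 := rfl
    rcases h0.eq_or_lt with rfl | h0
    · rcases h0'.eq_or_lt with rfl | h0'
      · linarith
      · rw [orientedPt_zero] at hr
        exact orientedPt_ne_vertexPt h0' h1' _ hr.symm
    · rcases eq_or_eq_of_orientedPt_eq h0 h1 h0' h1' hr with ⟨h8, -⟩ | ⟨-, h8⟩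
      · exact flip_ne d h8
      · linarith

theorem exists_dirPt_injective (x : G.Space) : ∃ η > 0, ∀ d d', G.IsDir x d → G.IsDir x d' →
    ∀ v v', 0 < v → v < η → 0 < v' → v' < η →
      G.dirPt x d v = G.dirPt x d' v' → d = d' ∧ v = v' := by
  have h : ∀ᶠ η in 𝓝[>] (0 : ℝ), ∀ d d', G.IsDir x d → G.IsDir x d' →
      ∀ v v', 0 < v → v < η → 0 < v' → v' < η →
        G.dirPt x d v = G.dirPt x d' v' → d = d' ∧ v = v' := by
    refine eventually_all.2 fun d => eventually_all.2 fun d' => ?_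
    by_cases h : G.IsDir x d
    · by_cases h' : G.IsDir x d'
      · filter_upwards [eventually_dirPt_eq_imp h h'] with η hη _ _ using hη
      · exact Eventually.of_forall fun _ _ h2 => absurd h2 h'
    · exact Eventually.of_forall fun _ h2 => absurd h2 h
  obtain ⟨η, h1, h2⟩ := (h.and eventually_pos_nhdsGT).exists
  exact ⟨η, h2, h1⟩

theorem dirSet_orientedPt {d : G.E × Bool} {r : ℝ} (h0 : 0 < r) (h1 : r < G.len d.1) :
    G.dirSet (orientedPt d r) = {d, flip d} := by
  ext d'
  rw [mem_dirSet, Finset.mem_insert, Finset.mem_singleton]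
  constructor
  · intro h
    obtain ⟨r', h0', h1', h⟩ := isDir_iff.1 h
    exact (eq_or_eq_of_orientedPt_eq h0 h1 h0' h1' h).imp And.left And.left
  · rintro (rfl | rfl)
    · exact isDir_orientedPt h0.le h1
    · rw [show orientedPt d r = orientedPt (flip d) (G.len d.1 - r) by simp [orientedPt_flip]]
      exact isDir_orientedPt (sub_nonneg.2 h1.le) (by simpa [flip] using h0)

theorem isDir_vertexPt_iff {v : G.V} {d : G.E × Bool} :
    G.IsDir (G.vertexPt v) d ↔ start d = v := by
  rw [isDir_iff]
  constructor
  · rintro ⟨r, h0, h1, h⟩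
    rcases h0.eq_or_lt with rfl | h0
    · rw [orientedPt_zero] at h
      exact (vertexPt_injective h).symm
    · exact absurd h.symm (orientedPt_ne_vertexPt h0 h1 _)
  · rintro rfl
    exact ⟨0, le_rfl, G.len_pos _, (orientedPt_zero d).symm⟩

/-- `F` is affine of slope `m` near `x` in the direction `d`. -/
def HasGerm (F : G.Space → ℝ) (x : G.Space) (d : G.E × Bool) (m : ℤ) : Prop :=
  ∀ᶠ u in 𝓝[>] (0 : ℝ), F (G.dirPt x d u) = F x + m * u

theorem HasGerm.rightSlope {f : RatFn G} {e : G.E} {t : ℝ} {m : ℤ} (h0 : 0 ≤ t)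
    (h1 : t < G.len e) (h : HasGerm f.toFun (G.edgePt e t) (e, true) m) :
    G.rightSlope f e t = m := by
  have h2 : HasDerivWithinAt (fun u => f.toFun (G.edgePt e u)) m (Set.Ici t) t := by
    have h3 : HasDerivWithinAt (fun u => f.toFun (G.edgePt e t) + m * (u - t)) m (Set.Ici t) t := by
      have : HasDerivAt (fun u => f.toFun (G.edgePt e t) + m * (u - t)) (m * 1 : ℝ) t :=
        (((hasDerivAt_id t).sub_const t).const_mul (m : ℝ)).const_add _
      simpa using this.hasDerivWithinAt
    obtain ⟨ε, hε, h⟩ := exists_pos_of_eventually h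
    refine h3.congr_of_eventuallyEq ?_ (by simp)
    filter_upwards [self_mem_nhdsWithin, nhdsWithin_le_nhds (Iio_mem_nhds (lt_add_of_pos_right t hε))]
      with u (h4 : t ≤ u) (h5 : u < t + ε)
    rcases h4.eq_or_lt with rfl | h4
    · simp
    · have h6 := h (u - t) (by linarith) (by linarith)
      have h7 := dirPt_orientedPt (G := G) (d := (e, true)) h0 h1 (u - t)
      simp only [orientedPt, if_true, add_sub_cancel] at h7
      rwa [h7] at h6
  exact h2.derivWithin (uniqueDiffOn_Ici t t Set.self_mem_Ici)

theorem HasGerm.leftSlope {f : RatFn G} {e : G.E} {t : ℝ} {m : ℤ} (h0 : 0 < t)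
    (h1 : t ≤ G.len e) (h : HasGerm f.toFun (G.edgePt e t) (e, false) m) :
    G.leftSlope f e t = -m := by
  have h2 : HasDerivWithinAt (fun u => f.toFun (G.edgePt e u)) (-m) (Set.Iic t) t := by
    have h3 : HasDerivWithinAt (fun u => f.toFun (G.edgePt e t) + -m * (u - t)) (-m)
        (Set.Iic t) t := by
      have : HasDerivAt (fun u => f.toFun (G.edgePt e t) + -m * (u - t)) (-m * 1 : ℝ) t :=
        (((hasDerivAt_id t).sub_const t).const_mul (-m : ℝ)).const_add _
      simpa using this.hasDerivWithinAt
    obtain ⟨ε, hε, h⟩ := exists_pos_of_eventually h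
    refine h3.congr_of_eventuallyEq ?_ (by simp)
    filter_upwards [self_mem_nhdsWithin, nhdsWithin_le_nhds (Ioi_mem_nhds (sub_lt_self t hε))]
      with u (h4 : u ≤ t) (h5 : t - ε < u)
    rcases h4.eq_or_lt with rfl | h4
    · simp
    · have h6 := h (t - u) (by linarith) (by linarith)
      have h7 := dirPt_orientedPt (G := G) (d := (e, false)) (r := G.len e - t) (by linarith)
        (by simpa using h0) (t - u)
      simp only [orientedPt, Bool.false_eq_true, if_false, sub_sub_cancel] at h7
      rw [h7, show G.len e - (G.len e - t + (t - u)) = u by ring] at h6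
      rw [h6]
      ring
  exact h2.derivWithin (uniqueDiffWithinAt_Iic t)

theorem ordAt_eq_sum {f : RatFn G} {x : G.Space} {s : G.E × Bool → ℤ}
    (hs : ∀ d ∈ G.dirSet x, HasGerm f.toFun x d (s d)) :
    G.ordAt f x = ((∑ d ∈ G.dirSet x, s d : ℤ) : ℝ) := by
  simp only [mem_dirSet] at hs
  rcases eq_vertexPt_or_edgePt x with ⟨v, rfl⟩ | ⟨e, t, h0, h1, rfl⟩
  · have h : ∃ w, G.vertexPt v = G.vertexPt w := ⟨v, rfl⟩
    have h2 : h.choose = v := (vertexPt_injective h.choose_spec).symm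
    rw [ordAt, dif_pos h, h2, dirSet, Finset.sum_filter, Fintype.sum_prod_type, Int.cast_sum]
    refine Finset.sum_congr rfl fun e _ => ?_
    simp only [Fintype.sum_bool, isDir_vertexPt_iff, start, if_true, Bool.false_eq_true, if_false]
    push_cast
    congr 1
    · by_cases h3 : G.src e = v
      · rw [if_pos h3, if_pos h3]
        subst h3
        refine HasGerm.rightSlope le_rfl (G.len_pos e) ?_
        rw [edgePt_zero]
        exact hs _ (isDir_vertexPt_iff.2 (by simp [start]))
      · rw [if_neg h3, if_neg h3]
    · by_cases h3 : G.tgt e = v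
      · rw [if_pos h3, if_pos h3]
        subst h3
        rw [HasGerm.leftSlope (m := s (e, false)) (G.len_pos e) le_rfl, neg_neg]
        rw [edgePt_len]
        exact hs _ (isDir_vertexPt_iff.2 (by simp [start]))
      · rw [if_neg h3, if_neg h3]
  · have h : ¬ ∃ w, G.edgePt e t = G.vertexPt w := fun ⟨w, hw⟩ => edgePt_ne_vertexPt h0 h1 w hw
    have h2 : ∃ p : G.E × ℝ, 0 < p.2 ∧ p.2 < G.len p.1 ∧ G.edgePt e t = G.edgePt p.1 p.2 :=
      ⟨(e, t), h0, h1, rfl⟩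
    have h3 : h2.choose = (e, t) := by
      obtain ⟨h4, h5, h6⟩ := h2.choose_spec
      have h7 := congrArg normalForm h6
      rw [normalForm_edgePt h0 h1, normalForm_edgePt h4 h5] at h7
      exact (Sum.inr_injective h7).symm
    have h8 : G.dirSet (G.edgePt e t) = {(e, true), (e, false)} :=
      dirSet_orientedPt (d := (e, true)) h0 h1
    have hs1 := hs (e, true) (mem_dirSet.1 (by simp [h8]))
    have hs2 := hs (e, false) (mem_dirSet.1 (by simp [h8]))
    rw [ordAt, dif_neg h, dif_pos h2, h3, hs1.rightSlope h0.le h1, hs2.leftSlope h0 h1.le, h8,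
      Finset.sum_pair (by simp)]
    push_cast
    ring

end Directions

section PiecewiseAffine

theorem le_of_forall_lt_succ {t : ℕ → ℝ} {n : ℕ} (h : ∀ i, i < n → t i < t (i + 1)) {i j : ℕ}
    (hij : i ≤ j) (hj : j ≤ n) : t i ≤ t j := by
  induction j, hij using Nat.le_induction with
  | base => exact le_rfl
  | succ k _ ih => exact (ih (by omega)).trans (h k (by omega)).le

theorem lt_of_forall_lt_succ {t : ℕ → ℝ} {n : ℕ} (h : ∀ i, i < n → t i < t (i + 1)) {i j : ℕ}
    (hij : i < j) (hj : j ≤ n) : t i < t j :=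
  (h i (by omega)).trans_le (le_of_forall_lt_succ h hij hj)

theorem exists_le_lt_succ {t : ℕ → ℝ} {n : ℕ} {s : ℝ} (h0 : t 0 ≤ s) (h1 : s < t n) :
    ∃ i < n, t i ≤ s ∧ s < t (i + 1) := by
  induction n with
  | zero => exact absurd h1 (not_lt.2 h0)
  | succ n ih =>
    rcases lt_or_ge s (t n) with h | h
    · obtain ⟨i, hi, h⟩ := ih h
      exact ⟨i, by omega, h⟩
    · exact ⟨n, by omega, h, h1⟩

theorem exists_lt_le_succ {t : ℕ → ℝ} {n : ℕ} {s : ℝ} (h0 : t 0 < s) (h1 : s ≤ t n) :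
    ∃ i < n, t i < s ∧ s ≤ t (i + 1) := by
  induction n with
  | zero => exact absurd h0 (not_lt.2 h1)
  | succ n ih =>
    rcases le_or_gt s (t n) with h | h
    · obtain ⟨i, hi, h⟩ := ih h
      exact ⟨i, by omega, h⟩
    · exact ⟨n, by omega, h, h1⟩

theorem _root_.PWIntAffine.extend {g : ℝ → ℝ} {a c : ℝ} (h : PWIntAffine g a) (hac : a < c) (m : ℤ)
    (b : ℝ) (hg : ∀ u, a ≤ u → u ≤ c → g u = m * u + b) : PWIntAffine g c := by
  obtain ⟨n, t, m', b', h0, hn, ht, hm⟩ := h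
  refine ⟨n + 1, fun i => if i ≤ n then t i else c, fun i => if i < n then m' i else m,
    fun i => if i < n then b' i else b, by simpa using h0, by simp, fun i hi => ?_,
    fun i hi u h1 h2 => ?_⟩
  · rcases (Nat.lt_succ_iff.1 hi).lt_or_eq with hi | rfl
    · simp only [if_pos hi.le, if_pos (Nat.succ_le_of_lt hi)]
      exact ht i hi
    · simpa [hn] using hac
  · rcases (Nat.lt_succ_iff.1 hi).lt_or_eq with hi | rfl
    · simp only [if_pos hi.le, if_pos (Nat.succ_le_of_lt hi)] at h1 h2
      simp only [if_pos hi]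
      exact hm i hi u h1 h2
    · simp only [le_refl, if_true, hn] at h1
      simp only [Nat.not_succ_le_self, if_false] at h2
      simp only [lt_irrefl, if_false]
      exact hg u h1 h2

theorem _root_.PWIntAffine.of_local {g : ℝ → ℝ} {L : ℝ} (hL : 0 ≤ L)
    (hr : ∀ t, 0 ≤ t → t < L → ∃ m : ℤ, ∀ᶠ u in 𝓝[>] (0 : ℝ), g (t + u) = g t + m * u)
    (hl : ∀ t, 0 < t → t ≤ L → ∃ m : ℤ, ∀ᶠ u in 𝓝[>] (0 : ℝ), g (t - u) = g t + m * u) :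
    PWIntAffine g L := by
  let S : Set ℝ := {s | 0 ≤ s ∧ s ≤ L ∧ PWIntAffine g s}
  have h0 : (0 : ℝ) ∈ S :=
    ⟨le_rfl, hL, 0, fun _ => 0, fun _ => 0, fun _ => 0, rfl, rfl, by simp, by simp⟩
  have hb : BddAbove S := ⟨L, fun s hs => hs.2.1⟩
  have hc0 : 0 ≤ sSup S := le_csSup hb h0
  have hcL : sSup S ≤ L := csSup_le ⟨0, h0⟩ fun s hs => hs.2.1
  have hc : sSup S ∈ S := by
    rcases hc0.eq_or_lt with hc0 | hc0
    · rwa [← hc0]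
    obtain ⟨m, hm⟩ := hl _ hc0 hcL
    obtain ⟨ε, hε, hm⟩ := exists_pos_of_eventually hm
    obtain ⟨s, hs, hs1⟩ := exists_lt_of_lt_csSup ⟨0, h0⟩ (sub_lt_self (sSup S) hε)
    rcases (le_csSup hb hs).eq_or_lt with hs2 | hs2
    · rwa [← hs2]
    refine ⟨hc0.le, hcL, hs.2.2.extend hs2 (-m) (g (sSup S) + m * sSup S) fun u h1 h2 => ?_⟩
    rcases h2.eq_or_lt with rfl | h2
    · push_cast; ring
    · have := hm (sSup S - u) (by linarith) (by linarith)
      rw [sub_sub_cancel] at this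
      rw [this]; push_cast; ring
  rcases hcL.eq_or_lt with h | h
  · exact h ▸ hc.2.2
  exfalso
  obtain ⟨m, hm⟩ := hr _ hc0 h
  obtain ⟨ε, hε, hm⟩ := exists_pos_of_eventually hm
  have hδ : 0 < min (ε / 2) (L - sSup S) := lt_min (by linarith) (by linarith)
  have hδ1 := min_le_left (ε / 2) (L - sSup S)
  have hδ2 := min_le_right (ε / 2) (L - sSup S)
  set δ := min (ε / 2) (L - sSup S)
  have hmem : sSup S + δ ∈ S := by
    refine ⟨by linarith, by linarith, hc.2.2.extend (by linarith) m (g (sSup S) - m * sSup S)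
      fun u h1 h2 => ?_⟩
    rcases h1.eq_or_lt with rfl | h1
    · ring
    · have := hm (u - sSup S) (by linarith) (by linarith)
      rw [add_sub_cancel] at this
      rw [this]; ring
  have := le_csSup hb hmem
  linarith

theorem _root_.PWIntAffine.continuousOn {g : ℝ → ℝ} {L : ℝ} (h : PWIntAffine g L) :
    ContinuousOn g (Set.Icc 0 L) := by
  obtain ⟨n, t, m, b, h0, rfl, ht, hm⟩ := h
  have key : ∀ i, i ≤ n → ContinuousOn g (Set.Icc 0 (t i)) := by
    intro i
    induction i with
    | zero => intro _; simp [h0]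
    | succ i ih =>
      intro hi
      have h1 : t i < t (i + 1) := ht i hi
      have h2 : 0 ≤ t i := h0 ▸ le_of_forall_lt_succ ht (Nat.zero_le i) (by omega)
      rw [← Set.Icc_union_Icc_eq_Icc h2 h1.le]
      refine (ih (by omega)).union_of_isClosed ?_ isClosed_Icc isClosed_Icc
      have h3 : ContinuousOn (fun u => (m i : ℝ) * u + b i) (Set.Icc (t i) (t (i + 1))) := by
        fun_prop
      exact h3.congr fun u hu => hm i hi u hu.1 hu.2
  exact key n le_rfl

end PiecewiseAffine

section RationalFunctions

variable {G : CombGraph}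

theorem dirPt_edgePt_true {e : G.E} {t : ℝ} (h0 : 0 ≤ t) (h1 : t < G.len e) (u : ℝ) :
    G.dirPt (G.edgePt e t) (e, true) u = G.edgePt e (t + u) :=
  dirPt_orientedPt (d := (e, true)) h0 h1 u

theorem dirPt_edgePt_false {e : G.E} {t : ℝ} (h0 : 0 < t) (h1 : t ≤ G.len e) (u : ℝ) :
    G.dirPt (G.edgePt e t) (e, false) u = G.edgePt e (t - u) := by
  have h := dirPt_orientedPt (G := G) (d := (e, false)) (r := G.len e - t) (by linarith)
    (by simpa using h0) u
  simp only [orientedPt, Bool.false_eq_true, if_false, sub_sub_cancel] at h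
  rw [h]
  congr 1
  ring

theorem isDir_edgePt_true {e : G.E} {t : ℝ} (h0 : 0 ≤ t) (h1 : t < G.len e) :
    G.IsDir (G.edgePt e t) (e, true) := by
  simp only [IsDir, if_true]
  exact ⟨t, h0, h1, rfl⟩

theorem isDir_edgePt_false {e : G.E} {t : ℝ} (h0 : 0 < t) (h1 : t ≤ G.len e) :
    G.IsDir (G.edgePt e t) (e, false) := by
  simp only [IsDir, Bool.false_eq_true, if_false]
  exact ⟨t, h0, h1, rfl⟩

theorem exists_edgePt_of_isDir_true {x : G.Space} {e : G.E} (h : G.IsDir x (e, true)) :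
    ∃ t, 0 ≤ t ∧ t < G.len e ∧ x = G.edgePt e t := by
  simpa [IsDir] using h

theorem exists_edgePt_of_isDir_false {x : G.Space} {e : G.E} (h : G.IsDir x (e, false)) :
    ∃ t, 0 < t ∧ t ≤ G.len e ∧ x = G.edgePt e t := by
  simpa [IsDir] using h

theorem HasGerm.unique {F : G.Space → ℝ} {x : G.Space} {d : G.E × Bool} {m m' : ℤ}
    (h : HasGerm F x d m) (h' : HasGerm F x d m') : m = m' := by
  obtain ⟨u, ⟨h1, h2⟩, h3⟩ := ((Eventually.and h h').and eventually_pos_nhdsGT).exists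
  have h4 : (m : ℝ) * u = m' * u := by linarith
  exact_mod_cast mul_right_cancel₀ h3.ne' h4

theorem hasGerm_true_of_affine {F : G.Space → ℝ} {e : G.E} {a c t b : ℝ} {m : ℤ} (h0 : 0 ≤ a)
    (h1 : c ≤ G.len e) (hat : a ≤ t) (htc : t < c)
    (h : ∀ u, a ≤ u → u ≤ c → F (G.edgePt e u) = m * u + b) :
    HasGerm F (G.edgePt e t) (e, true) m := by
  filter_upwards [eventually_lt_nhdsGT (sub_pos.2 htc), eventually_pos_nhdsGT] with u hu hu0
  rw [dirPt_edgePt_true (by linarith) (by linarith), h _ (by linarith) (by linarith),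
    h t hat htc.le]
  ring

theorem hasGerm_false_of_affine {F : G.Space → ℝ} {e : G.E} {a c t b : ℝ} {m : ℤ} (h0 : 0 ≤ a)
    (h1 : c ≤ G.len e) (hat : a < t) (htc : t ≤ c)
    (h : ∀ u, a ≤ u → u ≤ c → F (G.edgePt e u) = m * u + b) :
    HasGerm F (G.edgePt e t) (e, false) (-m) := by
  filter_upwards [eventually_lt_nhdsGT (sub_pos.2 hat), eventually_pos_nhdsGT] with u hu hu0
  rw [dirPt_edgePt_false (by linarith) (by linarith), h _ (by linarith) (by linarith),
    h t hat.le htc]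
  push_cast
  ring

theorem exists_hasGerm (f : RatFn G) {x : G.Space} {d : G.E × Bool} (h : G.IsDir x d) :
    ∃ m, HasGerm f.toFun x d m := by
  obtain ⟨e, b⟩ := d
  obtain ⟨n, t, m, b', h0, hn, ht, hm⟩ := f.piecewise e
  have hlo : ∀ i, i < n → 0 ≤ t i := fun i hi =>
    h0 ▸ le_of_forall_lt_succ ht (Nat.zero_le i) hi.le
  have hhi : ∀ i, i < n → t (i + 1) ≤ G.len e := fun i hi => hn ▸ le_of_forall_lt_succ ht hi le_rfl
  cases b
  · obtain ⟨s, hs0, hs1, rfl⟩ := exists_edgePt_of_isDir_false h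
    obtain ⟨i, hi, h1, h2⟩ := exists_lt_le_succ (h0.symm ▸ hs0) (hn.symm ▸ hs1)
    exact ⟨-m i, hasGerm_false_of_affine (hlo i hi) (hhi i hi) h1 h2 (hm i hi)⟩
  · obtain ⟨s, hs0, hs1, rfl⟩ := exists_edgePt_of_isDir_true h
    obtain ⟨i, hi, h1, h2⟩ := exists_le_lt_succ (h0.symm ▸ hs0) (hn.symm ▸ hs1)
    exact ⟨m i, hasGerm_true_of_affine (hlo i hi) (hhi i hi) h1 h2 (hm i hi)⟩

/-- A function with integral slopes in all directions at all points is rational. -/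
def _root_.RatFn.ofGerms (F : G.Space → ℝ) (hF : ∀ x d, G.IsDir x d → ∃ m, HasGerm F x d m) :
    RatFn G :=
  have hpw : ∀ e : G.E, PWIntAffine (fun t => F (G.edgePt e t)) (G.len e) := by
    refine fun e => PWIntAffine.of_local (G.len_pos e).le (fun t h0 h1 => ?_) fun t h0 h1 => ?_
    · obtain ⟨m, hm⟩ := hF _ _ (isDir_edgePt_true h0 h1)
      refine ⟨m, Eventually.mono hm fun u hu => ?_⟩
      rwa [dirPt_edgePt_true h0 h1] at hu
    · obtain ⟨m, hm⟩ := hF _ _ (isDir_edgePt_false h0 h1)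
      refine ⟨m, Eventually.mono hm fun u hu => ?_⟩
      rwa [dirPt_edgePt_false h0 h1] at hu
  { toFun := F
    continuous := by
      refine continuous_of_edges fun e => ?_
      have h : Continuous fun t => F (G.edgePt e (G.clamp e t)) :=
        (hpw e).continuousOn.comp_continuous (f := G.clamp e) (by unfold clamp; fun_prop)
          (clamp_mem e)
      simpa only [edgePt_clamp] using h
    piecewise := hpw }

theorem degDiv_eq_zero_of_isPrincipal {D : G.Div} {f : RatFn G} (h : G.IsPrincipal D f) :
    G.degDiv D = 0 := by
  choose n t m b h0 hn ht hm using f.piecewise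
  have hlo : ∀ e i, i ≤ n e → 0 ≤ t e i := fun e i hi =>
    h0 e ▸ le_of_forall_lt_succ (ht e) (Nat.zero_le i) hi
  have hhi : ∀ e i, i ≤ n e → t e i ≤ G.len e := fun e i hi =>
    hn e ▸ le_of_forall_lt_succ (ht e) hi le_rfl
  have hs : ∀ x d, ∃ s : ℤ, G.IsDir x d → HasGerm f.toFun x d s := by
    intro x d
    by_cases hd : G.IsDir x d
    · obtain ⟨s, hs⟩ := exists_hasGerm f hd
      exact ⟨s, fun _ => hs⟩
    · exact ⟨0, fun hd' => absurd hd' hd⟩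
  choose s hs using hs
  have hD : ∀ x, D x = ∑ d ∈ G.dirSet x, s x d := fun x => by
    have h1 := h x
    rw [ordAt_eq_sum (s := s x) fun d hd => hs x d (mem_dirSet.1 hd)] at h1
    exact_mod_cast h1
  have hst : ∀ e i r, i < n e → t e i ≤ r → r < t e (i + 1) →
      s (G.edgePt e r) (e, true) = m e i := fun e i r hi h1 h2 =>
    HasGerm.unique
      (hs _ _ (isDir_edgePt_true ((hlo e i hi.le).trans h1) (h2.trans_le (hhi e _ hi))))
      (hasGerm_true_of_affine (hlo e i hi.le) (hhi e _ hi) h1 h2 (hm e i hi))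
  have hsf : ∀ e i r, i < n e → t e i < r → r ≤ t e (i + 1) →
      s (G.edgePt e r) (e, false) = -m e i := fun e i r hi h1 h2 =>
    HasGerm.unique
      (hs _ _ (isDir_edgePt_false ((hlo e i hi.le).trans_lt h1) (h2.trans (hhi e _ hi))))
      (hasGerm_false_of_affine (hlo e i hi.le) (hhi e _ hi) h1 h2 (hm e i hi))
  let T : Finset G.Space := Finset.univ.image G.vertexPt ∪
    Finset.univ.biUnion fun e => (Finset.range (n e + 1)).image fun i => G.edgePt e (t e i)
  have hTmem : ∀ e i, i ≤ n e → G.edgePt e (t e i) ∈ T := fun e i hi =>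
    Finset.mem_union_right _ (Finset.mem_biUnion.2 ⟨e, Finset.mem_univ _,
      Finset.mem_image.2 ⟨i, Finset.mem_range.2 (by omega), rfl⟩⟩)
  have hT : ∀ e r, 0 ≤ r → r ≤ G.len e → G.edgePt e r ∈ T → ∃ i ≤ n e, r = t e i := by
    intro e r hr0 hr1 hr
    rcases hr0.eq_or_lt with rfl | hr0
    · exact ⟨0, Nat.zero_le _, (h0 e).symm⟩
    rcases hr1.eq_or_lt with rfl | hr1
    · exact ⟨n e, le_rfl, (hn e).symm⟩
    rcases Finset.mem_union.1 hr with hr | hr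
    · obtain ⟨v, -, hv⟩ := Finset.mem_image.1 hr
      exact absurd hv.symm (edgePt_ne_vertexPt hr0 hr1 v)
    · obtain ⟨e', -, hr⟩ := Finset.mem_biUnion.1 hr
      obtain ⟨i, hi, hr⟩ := Finset.mem_image.1 hr
      have hi : i ≤ n e' := by simpa [Nat.lt_succ_iff] using hi
      rcases (hlo e' i hi).eq_or_lt with h1 | h1
      · rw [← h1, edgePt_zero] at hr
        exact absurd hr.symm (edgePt_ne_vertexPt hr0 hr1 _)
      rcases (hhi e' i hi).eq_or_lt with h2 | h2
      · rw [h2, edgePt_len] at hr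
        exact absurd hr.symm (edgePt_ne_vertexPt hr0 hr1 _)
      have h3 := congrArg normalForm hr
      rw [normalForm_edgePt h1 h2, normalForm_edgePt hr0 hr1] at h3
      simp only [Sum.inr.injEq, Prod.mk.injEq] at h3
      obtain ⟨rfl, h3⟩ := h3
      exact ⟨i, hi, h3.symm⟩
  have hsupp : D.support ⊆ T := by
    intro x hx
    by_contra hxT
    rw [Finsupp.mem_support_iff, hD] at hx
    rcases eq_vertexPt_or_edgePt x with ⟨v, rfl⟩ | ⟨e, r, hr0, hr1, rfl⟩
    · exact hxT (Finset.mem_union_left _ (Finset.mem_image_of_mem _ (Finset.mem_univ v)))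
    · obtain ⟨i, hi, h1, h2⟩ := exists_le_lt_succ ((h0 e).symm ▸ hr0.le) ((hn e).symm ▸ hr1)
      have h3 : t e i < r := h1.lt_of_ne fun h3 => hxT (h3 ▸ hTmem e i hi.le)
      have h4 : G.dirSet (G.edgePt e r) = {(e, true), (e, false)} :=
        dirSet_orientedPt (d := (e, true)) hr0 hr1
      rw [h4, Finset.sum_pair (by simp), hst e i r hi h1 h2, hsf e i r hi h3 h2.le] at hx
      simp at hx
  have hinj : ∀ e i j, i ≤ n e → j ≤ n e → t e i = t e j → i = j := by
    intro e i j hi hj hij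
    rcases lt_trichotomy i j with h1 | h1 | h1
    · exact absurd hij (lt_of_forall_lt_succ (ht e) h1 hj).ne
    · exact h1
    · exact absurd hij (lt_of_forall_lt_succ (ht e) h1 hi).ne'
  have hsum1 : ∀ e, ∑ x ∈ T with G.IsDir x (e, true), s x (e, true) =
      ∑ i ∈ Finset.range (n e), m e i := by
    intro e
    symm
    refine Finset.sum_bij (fun i _ => G.edgePt e (t e i)) ?_ ?_ ?_ ?_
    · intro i hi
      have hi := Finset.mem_range.1 hi
      exact Finset.mem_filter.2 ⟨hTmem e i hi.le, isDir_edgePt_true (hlo e i hi.le)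
        ((ht e i hi).trans_le (hhi e _ hi))⟩
    · intro i hi j hj hij
      have hi := Finset.mem_range.1 hi
      have hj := Finset.mem_range.1 hj
      exact hinj e i j hi.le hj.le (orientedPt_injOn (d := (e, true)) (hlo e i hi.le)
        ((ht e i hi).trans_le (hhi e _ hi)) (hlo e j hj.le) ((ht e j hj).trans_le (hhi e _ hj)) hij)
    · intro x hx
      obtain ⟨hx, hd⟩ := Finset.mem_filter.1 hx
      obtain ⟨r, hr0, hr1, rfl⟩ := exists_edgePt_of_isDir_true hd
      obtain ⟨i, hi, rfl⟩ := hT e r hr0 hr1.le hx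
      refine ⟨i, Finset.mem_range.2 (hi.lt_of_ne ?_), rfl⟩
      rintro rfl
      exact hr1.ne (hn e)
    · intro i hi
      have hi := Finset.mem_range.1 hi
      exact (hst e i _ hi le_rfl (ht e i hi)).symm
  have hsum2 : ∀ e, ∑ x ∈ T with G.IsDir x (e, false), s x (e, false) =
      ∑ i ∈ Finset.range (n e), -m e i := by
    intro e
    symm
    refine Finset.sum_bij (fun i _ => G.edgePt e (t e (i + 1))) ?_ ?_ ?_ ?_
    · intro i hi
      have hi := Finset.mem_range.1 hi
      exact Finset.mem_filter.2 ⟨hTmem e (i + 1) hi, isDir_edgePt_false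
        ((hlo e i hi.le).trans_lt (ht e i hi)) (hhi e _ hi)⟩
    · intro i hi j hj hij
      have hi := Finset.mem_range.1 hi
      have hj := Finset.mem_range.1 hj
      have h1 := orientedPt_injOn (G := G) (d := (e, false)) (r := G.len e - t e (i + 1))
        (r' := G.len e - t e (j + 1)) (sub_nonneg.2 (hhi e _ hi))
        (sub_lt_self _ ((hlo e i hi.le).trans_lt (ht e i hi))) (sub_nonneg.2 (hhi e _ hj))
        (sub_lt_self _ ((hlo e j hj.le).trans_lt (ht e j hj))) (by simpa [orientedPt] using hij)
      have := hinj e (i + 1) (j + 1) hi hj (by linarith)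
      omega
    · intro x hx
      obtain ⟨hx, hd⟩ := Finset.mem_filter.1 hx
      obtain ⟨r, hr0, hr1, rfl⟩ := exists_edgePt_of_isDir_false hd
      obtain ⟨i, hi, rfl⟩ := hT e r hr0.le hr1 hx
      obtain _ | i := i
      · exact absurd (h0 e) hr0.ne'
      · exact ⟨i, Finset.mem_range.2 hi, rfl⟩
    · intro i hi
      have hi := Finset.mem_range.1 hi
      exact (hsf e i _ hi (ht e i hi) le_rfl).symm
  calc G.degDiv D = ∑ x ∈ T, D x :=
        Finsupp.sum_of_support_subset D hsupp (fun _ k => k) fun _ _ => rfl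
    _ = ∑ x ∈ T, ∑ d, if G.IsDir x d then s x d else 0 := by
        simp only [hD, dirSet, Finset.sum_filter]
    _ = ∑ d, ∑ x ∈ T with G.IsDir x d, s x d := by
        rw [Finset.sum_comm]
        simp only [Finset.sum_filter]
    _ = 0 := by
        rw [Fintype.sum_prod_type]
        refine Finset.sum_eq_zero fun e _ => ?_
        rw [Fintype.sum_bool, hsum1, hsum2, Finset.sum_neg_distrib, add_neg_cancel]

end RationalFunctions


theorem dirPt_flip {G : CombGraph} {d : G.E × Bool} {r : ℝ} (h0 : 0 < r) (h1 : r < G.len d.1)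
    (u : ℝ) : G.dirPt (orientedPt d r) (flip d) u = orientedPt d (r - u) := by
  have h := dirPt_orientedPt (G := G) (d := flip d) (r := G.len d.1 - r) (sub_nonneg.2 h1.le)
    (by simpa [flip] using h0) u
  rw [orientedPt_flip, orientedPt_flip, sub_sub_cancel] at h
  rw [h]
  congr 1
  ring

theorem tendsto_const_mul_nhdsGT {c : ℝ} (hc : 0 < c) :
    Tendsto (fun v : ℝ => c * v) (𝓝[>] 0) (𝓝[>] 0) := by
  refine tendsto_nhdsWithin_iff.2 ⟨?_, ?_⟩
  · have h : Continuous fun v : ℝ => c * v := by fun_prop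
    simpa using (h.tendsto 0).mono_left nhdsWithin_le_nhds
  · filter_upwards [eventually_pos_nhdsGT] with v hv using mul_pos hc hv

theorem tendsto_div_const_nhdsGT {c : ℝ} (hc : 0 < c) :
    Tendsto (fun v : ℝ => v / c) (𝓝[>] 0) (𝓝[>] 0) := by
  simpa only [div_eq_inv_mul] using tendsto_const_mul_nhdsGT (inv_pos.2 hc)

end CombGraph

namespace TropCover

open Filter Topology CombGraph

variable {Γ Δ : CombGraph} (π : TropCover Γ Δ)

theorem mem_fiber {x : Γ.Space} {y : Δ.Space} : x ∈ π.fiber y ↔ π.toFun x = y := by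
  simp [fiber]

theorem eventually_toFun_dirPt {x : Γ.Space} {d : Γ.E × Bool} (h : Γ.IsDir x d) :
    ∀ᶠ u in 𝓝[>] (0 : ℝ), π.toFun (Γ.dirPt x d u) =
      Δ.dirPt (π.toFun x) (π.dirMap x d) (π.slope x d * u) := by
  obtain ⟨ε, hε, h⟩ := π.locAffine x d h
  exact eventually_of_exists_pos ⟨ε, hε, fun u h0 h1 => h u h0.le h1.le⟩

theorem slope_pos {x : Γ.Space} {d : Γ.E × Bool} (h : Γ.IsDir x d) : 0 < π.slope x d := by
  by_contra hs
  have hs : π.slope x d = 0 := by omega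
  obtain ⟨ε, hε, h1⟩ := exists_pos_of_eventually (π.eventually_toFun_dirPt h)
  obtain ⟨η, hη, h2⟩ := exists_dirPt_injective x
  have hinj : Set.InjOn (Γ.dirPt x d) (Set.Ioo 0 (min ε η)) := fun u hu v hv huv =>
    (h2 d d h h u v hu.1 (hu.2.trans_le (min_le_right _ _)) hv.1
      (hv.2.trans_le (min_le_right _ _)) huv).2
  refine Set.Ioo_infinite (lt_min hε hη) (Set.Finite.of_finite_image
    ((π.finiteFibers (π.toFun x)).subset ?_) hinj)
  rintro _ ⟨u, hu, rfl⟩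
  have h3 := h1 u hu.1 (hu.2.trans_le (min_le_left _ _))
  rw [hs, Nat.cast_zero, zero_mul, dirPt_zero (π.dirMap_isDir x d h)] at h3
  exact h3

theorem cast_slope_pos {x : Γ.Space} {d : Γ.E × Bool} (h : Γ.IsDir x d) :
    (0 : ℝ) < π.slope x d :=
  Nat.cast_pos.2 (π.slope_pos h)

theorem dirMap_eq_and_slope_eq {z : Γ.Space} {d : Γ.E × Bool} {d' : Δ.E × Bool} {s : ℝ}
    (hd : Γ.IsDir z d) (hd' : Δ.IsDir (π.toFun z) d') (hs : 0 < s)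
    (h : ∀ᶠ v in 𝓝[>] (0 : ℝ), π.toFun (Γ.dirPt z d v) = Δ.dirPt (π.toFun z) d' (s * v)) :
    π.dirMap z d = d' ∧ (π.slope z d : ℝ) = s := by
  obtain ⟨η, hη, hinj⟩ := exists_dirPt_injective (π.toFun z)
  have hs' := π.cast_slope_pos hd
  obtain ⟨v, h1, h2, h3, h4, h5⟩ := (h.and ((π.eventually_toFun_dirPt hd).and
    (((tendsto_const_mul_nhdsGT hs).eventually (eventually_lt_nhdsGT hη)).and
    (((tendsto_const_mul_nhdsGT hs').eventually (eventually_lt_nhdsGT hη)).and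
    eventually_pos_nhdsGT)))).exists
  obtain ⟨h6, h7⟩ := hinj _ _ (π.dirMap_isDir z d hd) hd' _ _ (mul_pos hs' h5) h4 (mul_pos hs h5)
    h3 (h2.symm.trans h1)
  exact ⟨h6, mul_right_cancel₀ h5.ne' h7⟩

theorem eventually_localDeg_dirPt {x : Γ.Space} {d : Γ.E × Bool} (h : Γ.IsDir x d) :
    ∀ᶠ u in 𝓝[>] (0 : ℝ), π.localDeg (Γ.dirPt x d u) = π.slope x d := by
  have hs := π.cast_slope_pos h
  obtain ⟨ε, hε, haff⟩ := exists_pos_of_eventually (π.eventually_toFun_dirPt h)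
  obtain ⟨r', h0', h1', hr'⟩ := isDir_iff.1 (π.dirMap_isDir x d h)
  obtain ⟨r, h0, h1, rfl⟩ := isDir_iff.1 h
  rw [hr'] at haff
  simp only [dirPt_orientedPt h0 h1, dirPt_orientedPt h0' h1'] at haff ⊢
  set d' := π.dirMap (orientedPt d r) d
  set s := π.slope (orientedPt d r) d
  filter_upwards [eventually_pos_nhdsGT, eventually_lt_nhdsGT hε,
    eventually_lt_nhdsGT (sub_pos.2 h1),
    (tendsto_const_mul_nhdsGT hs).eventually (eventually_lt_nhdsGT (sub_pos.2 h1'))]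
    with u hu0 huε hu1 hu1'
  have hsu : 0 < (s : ℝ) * u := mul_pos hs hu0
  have hz0 : 0 < r + u := by linarith
  have hz1 : r + u < Γ.len d.1 := by linarith
  have hw0 : 0 < r' + s * u := by linarith
  have hw1 : r' + s * u < Δ.len d'.1 := by linarith
  have hw := haff u hu0 huε
  have hdirs := dirSet_orientedPt (G := Γ) hz0 hz1
  have hdirs' := dirSet_orientedPt (G := Δ) hw0 hw1
  have hd' : Δ.IsDir (π.toFun (orientedPt d (r + u))) d' := by
    rw [hw]; exact isDir_orientedPt hw0.le hw1
  have key1 := π.dirMap_eq_and_slope_eq (z := orientedPt d (r + u)) (d := d)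
    (isDir_orientedPt hz0.le hz1) hd' hs (by
      filter_upwards [eventually_lt_nhdsGT (sub_pos.2 huε), eventually_pos_nhdsGT] with v hv hv0
      rw [dirPt_orientedPt hz0.le hz1, hw, dirPt_orientedPt hw0.le hw1, add_assoc,
        haff _ (by linarith) (by linarith)]
      congr 1
      ring)
  have key2 := π.dirMap_eq_and_slope_eq (z := orientedPt d (r + u)) (d := flip d)
    (d' := flip d') (mem_dirSet.1 (by simp [hdirs])) (by
      rw [hw]; exact mem_dirSet.1 (by simp [hdirs'])) hs (by
      filter_upwards [eventually_lt_nhdsGT hu0, eventually_pos_nhdsGT] with v hv hv0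
      rw [dirPt_flip hz0 hz1, hw, dirPt_flip hw0 hw1, add_sub_assoc,
        haff _ (by linarith) (by linarith)]
      congr 1
      ring)
  rw [π.localDeg_spec _ d' hd', hdirs, Finset.filter_insert, Finset.filter_singleton,
    if_pos key1.1, if_neg (by rw [key2.1]; exact flip_ne d')]
  simpa using key1.2

/-- The outgoing directions at points over `y` which map to the direction `d'` at `y`. -/
def dirsOver (y : Δ.Space) (d' : Δ.E × Bool) : Finset (Γ.Space × (Γ.E × Bool)) :=
  (π.fiber y ×ˢ Finset.univ).filter fun p => Γ.IsDir p.1 p.2 ∧ π.dirMap p.1 p.2 = d'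

theorem mem_dirsOver {y : Δ.Space} {d' : Δ.E × Bool} {p : Γ.Space × (Γ.E × Bool)} :
    p ∈ π.dirsOver y d' ↔ π.toFun p.1 = y ∧ Γ.IsDir p.1 p.2 ∧ π.dirMap p.1 p.2 = d' := by
  simp [dirsOver, mem_fiber]

theorem sum_dirsOver {M : Type*} [AddCommMonoid M] (y : Δ.Space) (d' : Δ.E × Bool)
    (h : Γ.Space × (Γ.E × Bool) → M) :
    ∑ p ∈ π.dirsOver y d', h p =
      ∑ x ∈ π.fiber y, ∑ d ∈ (Γ.dirSet x).filter (fun d => π.dirMap x d = d'), h (x, d) := by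
  rw [dirsOver, Finset.sum_filter, Finset.sum_product]
  refine Finset.sum_congr rfl fun x _ => ?_
  rw [dirSet, Finset.filter_filter, Finset.sum_filter]

theorem eventually_of_toFun_eq {x : Γ.Space} {d : Γ.E × Bool} (h : Γ.IsDir x d)
    (d' : Δ.E × Bool) (hd' : Δ.IsDir (π.toFun x) d') :
    ∃ ε > 0, ∀ᶠ v in 𝓝[>] (0 : ℝ), ∀ u, 0 < u → u < ε →
      π.toFun (Γ.dirPt x d u) = Δ.dirPt (π.toFun x) d' v →
        π.dirMap x d = d' ∧ u = v / π.slope x d := by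
  have hs := π.cast_slope_pos h
  obtain ⟨η, hη, hinj⟩ := exists_dirPt_injective (π.toFun x)
  obtain ⟨ε, hε, hu⟩ := exists_pos_of_eventually ((π.eventually_toFun_dirPt h).and
    ((tendsto_const_mul_nhdsGT hs).eventually (eventually_lt_nhdsGT hη)))
  refine ⟨ε, hε, ?_⟩
  filter_upwards [eventually_lt_nhdsGT hη, eventually_pos_nhdsGT] with v hv hv0 u hu0 hu1 huv
  obtain ⟨h1, h2⟩ := hu u hu0 hu1
  obtain ⟨h3, h4⟩ := hinj _ _ (π.dirMap_isDir x d h) hd' _ _ (mul_pos hs hu0) h2 hv0 hv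
    (h1.symm.trans huv)
  exact ⟨h3, by rw [← h4]; field_simp⟩

theorem eventually_forall_edgePt (y : Δ.Space) {d' : Δ.E × Bool} (hd' : Δ.IsDir y d')
    (e : Γ.E) : ∀ᶠ v in 𝓝[>] (0 : ℝ), ∀ t ∈ Set.Icc 0 (Γ.len e),
      π.toFun (Γ.edgePt e t) = Δ.dirPt y d' v → ∃ p ∈ π.dirsOver y d',
        Γ.edgePt e t = Γ.dirPt p.1 p.2 (v / π.slope p.1 p.2) := by
  refine isCompact_Icc.induction_on (p := fun s => ∀ᶠ v in 𝓝[>] (0 : ℝ), ∀ t ∈ s,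
      π.toFun (Γ.edgePt e t) = Δ.dirPt y d' v → ∃ p ∈ π.dirsOver y d',
        Γ.edgePt e t = Γ.dirPt p.1 p.2 (v / π.slope p.1 p.2)) (by simp) ?_ ?_ ?_
  · intro s s' hss h
    filter_upwards [h] with v hv t ht using hv t (hss ht)
  · intro s s' h h'
    filter_upwards [h, h'] with v hv hv' t ht
    exact ht.elim (hv t) (hv' t)
  · intro t ht
    by_cases hy : π.toFun (Γ.edgePt e t) = y
    · subst hy
      have hright : ∃ ε > 0, ∀ᶠ v in 𝓝[>] (0 : ℝ), ∀ u, 0 < u → u < ε → t + u ≤ Γ.len e →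
          π.toFun (Γ.edgePt e (t + u)) = Δ.dirPt (π.toFun (Γ.edgePt e t)) d' v →
          ∃ p ∈ π.dirsOver (π.toFun (Γ.edgePt e t)) d',
            Γ.edgePt e (t + u) = Γ.dirPt p.1 p.2 (v / π.slope p.1 p.2) := by
        rcases ht.2.lt_or_eq with h1 | h1
        · have hd := isDir_edgePt_true ht.1 h1
          obtain ⟨ε, hε, hev⟩ := π.eventually_of_toFun_eq hd d' hd'
          refine ⟨ε, hε, hev.mono fun v hv u hu0 hu1 _ huv => ?_⟩
          rw [← dirPt_edgePt_true ht.1 h1] at huv ⊢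
          obtain ⟨h2, h3⟩ := hv u hu0 hu1 huv
          exact ⟨(Γ.edgePt e t, (e, true)), π.mem_dirsOver.2 ⟨rfl, hd, h2⟩, congrArg _ h3⟩
        · exact ⟨1, one_pos, Eventually.of_forall fun v u hu0 _ hu2 => by linarith⟩
      have hleft : ∃ ε > 0, ∀ᶠ v in 𝓝[>] (0 : ℝ), ∀ u, 0 < u → u < ε → 0 ≤ t - u →
          π.toFun (Γ.edgePt e (t - u)) = Δ.dirPt (π.toFun (Γ.edgePt e t)) d' v →
          ∃ p ∈ π.dirsOver (π.toFun (Γ.edgePt e t)) d',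
            Γ.edgePt e (t - u) = Γ.dirPt p.1 p.2 (v / π.slope p.1 p.2) := by
        rcases ht.1.lt_or_eq with h1 | h1
        · have hd := isDir_edgePt_false h1 ht.2
          obtain ⟨ε, hε, hev⟩ := π.eventually_of_toFun_eq hd d' hd'
          refine ⟨ε, hε, hev.mono fun v hv u hu0 hu1 _ huv => ?_⟩
          rw [← dirPt_edgePt_false h1 ht.2] at huv ⊢
          obtain ⟨h2, h3⟩ := hv u hu0 hu1 huv
          exact ⟨(Γ.edgePt e t, (e, false)), π.mem_dirsOver.2 ⟨rfl, hd, h2⟩, congrArg _ h3⟩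
        · exact ⟨1, one_pos, Eventually.of_forall fun v u hu0 _ hu2 => by linarith⟩
      obtain ⟨ε₁, hε₁, hr⟩ := hright
      obtain ⟨ε₂, hε₂, hl⟩ := hleft
      refine ⟨Set.Ioo (t - ε₂) (t + ε₁) ∩ Set.Icc 0 (Γ.len e), inter_mem
        (mem_nhdsWithin_of_mem_nhds (Ioo_mem_nhds (by linarith) (by linarith)))
        self_mem_nhdsWithin, ?_⟩
      filter_upwards [hr, hl, eventually_dirPt_ne hd'] with v hvr hvl hvne t' ht' htv
      rcases lt_trichotomy t' t with h1 | rfl | h1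
      · have h2 := hvl (t - t') (by linarith) (by linarith [ht'.1.1]) (by linarith [ht'.2.1])
        rw [sub_sub_cancel] at h2
        exact h2 htv
      · exact absurd htv.symm hvne
      · have h2 := hvr (t' - t) (by linarith) (by linarith [ht'.1.2]) (by linarith [ht'.2.2])
        rw [add_sub_cancel] at h2
        exact h2 htv
    · obtain ⟨U, W, hU, hW, hUt, hWy, hUW⟩ := t2_separation hy
      have hc : Continuous fun t => π.toFun (Γ.edgePt e t) :=
        π.continuous.comp (continuous_edgePt e)
      refine ⟨_, mem_nhdsWithin_of_mem_nhds ((hU.preimage hc).mem_nhds hUt), ?_⟩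
      filter_upwards [(tendsto_dirPt hd').eventually (hW.mem_nhds hWy)] with v hv t' ht' htv
      exact (hUW.ne_of_mem ht' hv htv).elim

theorem eventually_toFun_vertexPt_ne {y : Δ.Space} {d' : Δ.E × Bool} (hd' : Δ.IsDir y d')
    (w : Γ.V) : ∀ᶠ v in 𝓝[>] (0 : ℝ), π.toFun (Γ.vertexPt w) ≠ Δ.dirPt y d' v := by
  by_cases hy : π.toFun (Γ.vertexPt w) = y
  · filter_upwards [eventually_dirPt_ne hd'] with v hv h using hv (h.symm.trans hy)
  · filter_upwards [(tendsto_dirPt hd').eventually (isOpen_ne.mem_nhds (Ne.symm hy))]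
      with v hv using Ne.symm hv

theorem eventually_fiber_eq {y : Δ.Space} {d' : Δ.E × Bool} (hd' : Δ.IsDir y d') :
    ∀ᶠ v in 𝓝[>] (0 : ℝ), π.fiber (Δ.dirPt y d' v) =
      (π.dirsOver y d').image fun p => Γ.dirPt p.1 p.2 (v / π.slope p.1 p.2) := by
  have h1 : ∀ᶠ v in 𝓝[>] (0 : ℝ), ∀ p ∈ π.dirsOver y d',
      π.toFun (Γ.dirPt p.1 p.2 (v / π.slope p.1 p.2)) = Δ.dirPt y d' v := by
    refine (Finset.eventually_all _).2 fun p hp => ?_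
    obtain ⟨hpy, hp, hpd⟩ := π.mem_dirsOver.1 hp
    have hs := π.cast_slope_pos hp
    filter_upwards [(tendsto_div_const_nhdsGT hs).eventually (π.eventually_toFun_dirPt hp)]
      with v hv
    rw [hv, hpy, hpd, mul_div_cancel₀ _ hs.ne']
  filter_upwards [h1, eventually_all.2 (π.eventually_forall_edgePt y hd'),
    eventually_all.2 (π.eventually_toFun_vertexPt_ne hd')] with v hv1 hv2 hv3
  ext z
  rw [mem_fiber, Finset.mem_image]
  constructor
  · intro hz
    rcases eq_vertexPt_or_edgePt z with ⟨w, rfl⟩ | ⟨e, t, h0, h1, rfl⟩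
    · exact absurd hz (hv3 w)
    · obtain ⟨p, hp, h⟩ := hv2 e t ⟨h0.le, h1.le⟩ hz
      exact ⟨p, hp, h.symm⟩
  · rintro ⟨p, hp, rfl⟩
    exact hv1 p hp

theorem eventually_injOn_dirsOver (y : Δ.Space) (d' : Δ.E × Bool) :
    ∀ᶠ v in 𝓝[>] (0 : ℝ), ∀ p ∈ π.dirsOver y d', ∀ q ∈ π.dirsOver y d',
      Γ.dirPt p.1 p.2 (v / π.slope p.1 p.2) = Γ.dirPt q.1 q.2 (v / π.slope q.1 q.2) → p = q := by
  refine (Finset.eventually_all _).2 fun p hp => (Finset.eventually_all _).2 fun q hq => ?_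
  obtain ⟨x, d⟩ := p
  obtain ⟨x', d₁⟩ := q
  obtain ⟨-, hp, -⟩ := π.mem_dirsOver.1 hp
  obtain ⟨-, hq, -⟩ := π.mem_dirsOver.1 hq
  have tp := tendsto_div_const_nhdsGT (π.cast_slope_pos hp)
  have tq := tendsto_div_const_nhdsGT (π.cast_slope_pos hq)
  by_cases hx : x = x'
  · subst hx
    obtain ⟨η, hη, hinj⟩ := exists_dirPt_injective x
    filter_upwards [tp.eventually (eventually_lt_nhdsGT hη), tp.eventually eventually_pos_nhdsGT,
      tq.eventually (eventually_lt_nhdsGT hη), tq.eventually eventually_pos_nhdsGT]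
      with v h1 h2 h3 h4 h5
    exact congrArg (Prod.mk x) (hinj _ _ hp hq _ _ h2 h1 h4 h3 h5).1
  · obtain ⟨U, W, hU, hW, hUx, hWx, hUW⟩ := t2_separation hx
    filter_upwards [((tendsto_dirPt hp).comp tp).eventually (hU.mem_nhds hUx),
      ((tendsto_dirPt hq).comp tq).eventually (hW.mem_nhds hWx)] with v h1 h2 h3
    exact absurd h3 (hUW.ne_of_mem h1 h2)

/-- The pushforward of a function: the sum over the fibers weighted by local degrees. -/
def pushFn (F : Γ.Space → ℝ) (y : Δ.Space) : ℝ := ∑ x ∈ π.fiber y, (π.localDeg x : ℝ) * F x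

theorem hasGerm_pushFn {F : Γ.Space → ℝ} {s : Γ.Space → Γ.E × Bool → ℤ}
    (hs : ∀ x d, Γ.IsDir x d → HasGerm F x d (s x d)) {y : Δ.Space} {d' : Δ.E × Bool}
    (hd' : Δ.IsDir y d') :
    HasGerm (π.pushFn F) y d' (∑ p ∈ π.dirsOver y d', s p.1 p.2) := by
  have h1 : ∀ᶠ v in 𝓝[>] (0 : ℝ), ∀ p ∈ π.dirsOver y d',
      π.localDeg (Γ.dirPt p.1 p.2 (v / π.slope p.1 p.2)) = π.slope p.1 p.2 ∧
      F (Γ.dirPt p.1 p.2 (v / π.slope p.1 p.2)) = F p.1 + s p.1 p.2 * (v / π.slope p.1 p.2) := by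
    refine (Finset.eventually_all _).2 fun p hp => ?_
    obtain ⟨-, hp, -⟩ := π.mem_dirsOver.1 hp
    have tp := tendsto_div_const_nhdsGT (π.cast_slope_pos hp)
    exact (tp.eventually (π.eventually_localDeg_dirPt hp)).and (tp.eventually (hs _ _ hp))
  have h2 : π.pushFn F y = ∑ p ∈ π.dirsOver y d', (π.slope p.1 p.2 : ℝ) * F p.1 := by
    rw [sum_dirsOver, pushFn]
    refine Finset.sum_congr rfl fun x hx => ?_
    rw [mem_fiber] at hx
    subst hx
    rw [π.localDeg_spec x d' hd', Nat.cast_sum, Finset.sum_mul]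
  filter_upwards [h1, π.eventually_fiber_eq hd', π.eventually_injOn_dirsOver y d']
    with v hv1 hv2 hv3
  rw [h2, pushFn, hv2, Finset.sum_image fun p hp q hq h => hv3 p hp q hq h, Int.cast_sum,
    Finset.sum_mul, ← Finset.sum_add_distrib]
  refine Finset.sum_congr rfl fun p hp => ?_
  have hp' := (π.cast_slope_pos (π.mem_dirsOver.1 hp).2.1).ne'
  rw [(hv1 p hp).1, (hv1 p hp).2]
  field_simp

theorem pushforward_apply (A : Γ.Div) (y : Δ.Space) :
    π.pushforward A y = ∑ x ∈ π.fiber y, A x := by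
  rw [pushforward, Finsupp.mapDomain, Finsupp.sum_apply]
  simp only [Finsupp.single_apply, Finsupp.sum]
  rw [← Finset.sum_filter]
  refine Finset.sum_subset (fun x hx => ?_) fun x hx hx' => ?_
  · exact π.mem_fiber.2 (Finset.mem_filter.1 hx).2
  · by_contra h
    exact hx' (Finset.mem_filter.2 ⟨Finsupp.mem_support_iff.2 h, π.mem_fiber.1 hx⟩)

theorem exists_isPrincipal_pushforward {A : Γ.Div} {f : RatFn Γ} (h : Γ.IsPrincipal A f) :
    ∃ g : RatFn Δ, Δ.IsPrincipal (π.pushforward A) g := by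
  have hs : ∀ x d, ∃ s : ℤ, Γ.IsDir x d → HasGerm f.toFun x d s := by
    intro x d
    by_cases hd : Γ.IsDir x d
    · obtain ⟨s, hs⟩ := exists_hasGerm f hd
      exact ⟨s, fun _ => hs⟩
    · exact ⟨0, fun hd' => absurd hd' hd⟩
  choose s hs using hs
  refine ⟨RatFn.ofGerms (π.pushFn f.toFun) fun y d' hd' => ⟨_, π.hasGerm_pushFn hs hd'⟩,
    fun y => ?_⟩
  rw [ordAt_eq_sum fun d' hd' => π.hasGerm_pushFn hs (mem_dirSet.1 hd'), pushforward_apply]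
  simp only [sum_dirsOver]
  rw [Finset.sum_comm]
  congr 1
  refine Finset.sum_congr rfl fun x hx => ?_
  rw [mem_fiber] at hx
  subst hx
  rw [Finset.sum_fiberwise_of_maps_to fun d hd =>
    mem_dirSet.2 (π.dirMap_isDir x d (mem_dirSet.1 hd))]
  have h1 := h x
  rw [ordAt_eq_sum (s := s x) fun d hd => hs x d (mem_dirSet.1 hd)] at h1
  exact_mod_cast h1

theorem pushforward_sub (A B : Γ.Div) :
    π.pushforward (A - B) = π.pushforward A - π.pushforward B := by
  ext y
  simp [pushforward_apply]

theorem linEquiv_pushforward {A B : Γ.Div} (h : Γ.LinEquiv A B) :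
    Δ.LinEquiv (π.pushforward A) (π.pushforward B) := by
  obtain ⟨f, hf⟩ := h
  obtain ⟨g, hg⟩ := π.exists_isPrincipal_pushforward hf
  exact ⟨g, by rwa [pushforward_sub] at hg⟩

theorem effective_pushforward {A : Γ.Div} (h : Γ.Effective A) : Δ.Effective (π.pushforward A) :=
  fun y => by
    rw [pushforward_apply]
    exact Finset.sum_nonneg fun x _ => h x

theorem degDiv_pushforward (A : Γ.Div) : Δ.degDiv (π.pushforward A) = Γ.degDiv A :=
  Finsupp.sum_mapDomain_index (fun _ => rfl) fun _ _ _ => rfl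

theorem exists_effective_pushforward_eq {B : Δ.Div} (h : Δ.Effective B) :
    ∃ A : Γ.Div, Γ.Effective A ∧ π.pushforward A = B := by
  obtain ⟨σ, hσ⟩ := π.surjective.hasRightInverse
  refine ⟨Finsupp.mapDomain σ B, fun x => ?_, ?_⟩
  · rw [Finsupp.mapDomain, Finsupp.sum_apply]
    refine Finset.sum_nonneg fun y _ => ?_
    change 0 ≤ Finsupp.single (σ y) (B y) x
    rw [Finsupp.single_apply]
    split_ifs
    exacts [h y, le_rfl]
  · rw [pushforward, ← Finsupp.mapDomain_comp, hσ.id, Finsupp.mapDomain_id]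

end TropCover

namespace CombGraph

variable {G : CombGraph}

theorem degDiv_sub (A B : G.Div) : G.degDiv (A - B) = G.degDiv A - G.degDiv B :=
  Finsupp.sum_sub_index fun _ _ _ => rfl

theorem degDiv_nonneg {A : G.Div} (h : G.Effective A) : 0 ≤ G.degDiv A :=
  Finset.sum_nonneg fun x _ => h x

/-- The integers `k` such that `|D - E|` is nonempty for all effective `E` of degree `k`. -/
def rankSet (D : G.Div) : Set ℤ :=
  {k : ℤ | ∀ E : G.Div, G.Effective E → G.degDiv E = k →
    ∃ E' : G.Div, G.Effective E' ∧ G.LinEquiv (D - E) E'}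

theorem neg_one_mem_rankSet (D : G.Div) : -1 ∈ rankSet D := fun E hE h => by
  have := degDiv_nonneg hE
  omega

theorem bddAbove_rankSet [Nonempty G.Space] (D : G.Div) : BddAbove (rankSet D) := by
  refine ⟨max 0 (G.degDiv D), fun k hk => ?_⟩
  by_contra h
  obtain ⟨hk0, hkD⟩ := max_lt_iff.1 (not_le.1 h)
  obtain ⟨x⟩ := ‹Nonempty G.Space›
  have hdeg : G.degDiv (Finsupp.single x k) = k := Finsupp.sum_single_index rfl
  obtain ⟨E', hE', f, hf⟩ := hk (Finsupp.single x k) (fun y => by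
    rw [Finsupp.single_apply]
    split_ifs
    exacts [hk0.le, le_rfl]) hdeg
  have h1 := degDiv_eq_zero_of_isPrincipal hf
  rw [degDiv_sub, degDiv_sub, hdeg] at h1
  have h2 := degDiv_nonneg hE'
  omega

end CombGraph

theorem TropCover.rankSet_subset {Γ Δ : CombGraph} (π : TropCover Γ Δ) (A : Γ.Div) :
    CombGraph.rankSet A ⊆ CombGraph.rankSet (π.pushforward A) := by
  intro k hk E hE hdeg
  obtain ⟨B, hB, rfl⟩ := π.exists_effective_pushforward_eq hE
  obtain ⟨E', hE', h⟩ := hk B hB ((π.degDiv_pushforward B).symm.trans hdeg)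
  refine ⟨π.pushforward E', π.effective_pushforward hE', ?_⟩
  rw [← π.pushforward_sub]
  exact π.linEquiv_pushforward h

theorem TropCover.rk_le_rk_pushforward {Γ Δ : CombGraph} [Nonempty Δ.Space] (π : TropCover Γ Δ)
    (A : Γ.Div) : Γ.Rk A ≤ Δ.Rk (π.pushforward A) :=
  csSup_le_csSup (CombGraph.bddAbove_rankSet _) ⟨-1, CombGraph.neg_one_mem_rankSet A⟩
    (π.rankSet_subset A)

/-- the pushforward morphism of a tropical admissible cover preserves
effective divisors, linear equivalence and degrees, and does not decrease ranks. -/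
theorem pushforward_properties (Γ Δ : CombGraph)
    (hΓc : CompactSpace Γ.Space) (hΓ : ConnectedSpace Γ.Space)
    (hΔc : CompactSpace Δ.Space) (hΔ : ConnectedSpace Δ.Space)
    (π : TropCover Γ Δ) :
    (∀ A : Γ.Div, Γ.Effective A → Δ.Effective (π.pushforward A)) ∧
    (∀ A B : Γ.Div, Γ.LinEquiv A B → Δ.LinEquiv (π.pushforward A) (π.pushforward B)) ∧
    (∀ A : Γ.Div, Δ.degDiv (π.pushforward A) = Γ.degDiv A) ∧
    (∀ A : Γ.Div, Γ.Rk A ≤ Δ.Rk (π.pushforward A)) := by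
  exact ⟨fun _ => π.effective_pushforward, fun _ _ => π.linEquiv_pushforward,
    π.degDiv_pushforward, π.rk_le_rk_pushforward⟩
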